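/- For every integer k ≥ 3, setting r = 4/2^k, and for every integer n > 2^k: u_Opt(n, r + r²) ≤ n²·((3e/4)·r·n)^{4/r}. -/

import Mathlib

namespace TQ

/-- A decision tree: internal nodes are labeled by questions (subsets of `α`,
with the two children corresponding to Yes/No), leaves by elements of `α`. -/
inductive DTree (α : Type) where
  | leaf (x : α) : DTree α
  | node (q : Finset α) (yes no : DTree α) : DTree α

namespace DTree

variable {α : Type} [DecidableEq α]

/-- The list of leaf labels of a decision tree. -/
def leaves : DTree α → List α
  | .leaf x => [x]
  | .node _ t f => leaves t ++ leaves f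

/-- The set of questions appearing at internal nodes. -/
def questions : DTree α → Set (Finset α)
  | .leaf _ => ∅
  | .node q t f => insert q (questions t ∪ questions f)

/-- Follow the path of `x` (Yes-edge iff `x` belongs to the question);
returns `some d` iff the path ends at a leaf labeled `x`, at depth `d`. -/
def find? : DTree α → α → Option ℕ
  | .leaf y, x => if y = x then some 0 else none
  | .node q t f, x => (if x ∈ q then find? t x else find? f x).map (· + 1)

/-- The depth of the leaf labeled `x` (junk value `0` if the path of `x`
does not end at a leaf labeled `x`). -/
def depth (T : DTree α) (x : α) : ℕ := (T.find? x).getD 0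

end DTree

variable {α : Type} [Fintype α] [DecidableEq α]

/-- `μ` is a probability distribution on `α`. -/
def IsDistribution (μ : α → ℝ) : Prop := (∀ x, 0 ≤ μ x) ∧ ∑ x, μ x = 1

/-- `T` is valid for `μ`: its leaves are distinct, the set of leaf labels is the
support of `μ`, and for every `x` in the support the path of `x` ends at the
leaf labeled `x`. -/
structure IsValid (T : DTree α) (μ : α → ℝ) : Prop where
  nodup : T.leaves.Nodup
  mem_leaves : ∀ x, x ∈ T.leaves ↔ μ x ≠ 0
  finds : ∀ x, μ x ≠ 0 → T.find? x = some (T.depth x)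

/-- The cost of `T` on `μ`: the average depth `∑ x, μ(x) · T(x)`. -/
noncomputable def cost (T : DTree α) (μ : α → ℝ) : ℝ := ∑ x, μ x * (T.depth x : ℝ)

/-- All questions of `T` belong to `Q`. -/
def UsesQuestions (T : DTree α) (Q : Set (Finset α)) : Prop := T.questions ⊆ Q

/-- `Opt(μ)`: the optimal cost over all decision trees valid for `μ`. -/
noncomputable def OptCost (μ : α → ℝ) : ℝ :=
  sInf { c | ∃ T : DTree α, IsValid T μ ∧ c = cost T μ }

/-- `c_Q(μ)`: the optimal cost over decision trees valid for `μ`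
using only questions from `Q`. -/
noncomputable def cQ (Q : Set (Finset α)) (μ : α → ℝ) : ℝ :=
  sInf { c | ∃ T : DTree α, IsValid T μ ∧ UsesQuestions T Q ∧ c = cost T μ }

/-- The base-2 (Shannon) entropy of `μ`. (Note `Real.logb 2 0 = 0`.) -/
noncomputable def entropy (μ : α → ℝ) : ℝ := ∑ x, -(μ x * Real.logb 2 (μ x))

/-- `Q` achieves prolixity `r`: for every distribution there is a valid tree using
only questions from `Q` of cost at most `Opt(μ) + r`. -/
def AchievesProlixity {n : ℕ} (Q : Finset (Finset (Fin n))) (r : ℝ) : Prop :=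
  ∀ μ : Fin n → ℝ, IsDistribution μ →
    ∃ T : DTree (Fin n), IsValid T μ ∧ UsesQuestions T ↑Q ∧ cost T μ ≤ OptCost μ + r

/-- `Q` achieves redundancy `r`: for every distribution there is a valid tree using
only questions from `Q` of cost at most `H(μ) + r`. -/
def AchievesRedundancy {n : ℕ} (Q : Finset (Finset (Fin n))) (r : ℝ) : Prop :=
  ∀ μ : Fin n → ℝ, IsDistribution μ →
    ∃ T : DTree (Fin n), IsValid T μ ∧ UsesQuestions T ↑Q ∧ cost T μ ≤ entropy μ + r

/-- `u_Opt(n,r)`: the minimum cardinality of a set of questions achieving prolixity `r`. -/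
noncomputable def uOpt (n : ℕ) (r : ℝ) : ℕ :=
  sInf { k | ∃ Q : Finset (Finset (Fin n)), Q.card = k ∧ AchievesProlixity Q r }

/-- `u_H(n,r)`: the minimum cardinality of a set of questions achieving redundancy `r`. -/
noncomputable def uH (n : ℕ) (r : ℝ) : ℕ :=
  sInf { k | ∃ Q : Finset (Finset (Fin n)), Q.card = k ∧ AchievesRedundancy Q r }

end TQ

namespace TQ

section aux
variable {n : ℕ}

/-- The initial segment. -/
def Ini (n p : ℕ) : Finset (Fin n) := Finset.univ.filter (fun i => i.val < p)

/-- The question set. -/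
def QS (n s : ℕ) : Finset (Finset (Fin n)) :=
  ((Finset.range (n+1)) ×ˢ ((Finset.univ : Finset (Finset (Fin n))).filter (fun B => B.card ≤ s))).image
    (fun pB => symmDiff (Ini n pB.1) pB.2)

lemma mem_QS {s p : ℕ} (hp : p ≤ n) {B : Finset (Fin n)} (hB : B.card ≤ s) :
    symmDiff (Ini n p) B ∈ QS n s := by
  unfold QS
  refine Finset.mem_image.2 ⟨(p, B), ?_, rfl⟩
  simp [hB]; omega

lemma sep_exists {s p : ℕ} (hp : p ≤ n) {U1 U2 D1 D2 : Finset (Fin n)}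
    (hc : (U1 ∪ U2).card ≤ s) (hd : Disjoint (U1 ∪ D1) (U2 ∪ D2))
    (h1 : ∀ x ∈ D1, x.val < p) (h2 : ∀ x ∈ D2, p ≤ x.val)
    (hd1 : Disjoint (U1 ∪ U2) (D1 ∪ D2)) :
    ∃ q ∈ QS n s, (∀ x ∈ U1 ∪ D1, x ∈ q) ∧ (∀ x ∈ U2 ∪ D2, x ∉ q) := by
  refine ⟨symmDiff (Ini n p) ((U1 \ Ini n p) ∪ (U2 ∩ Ini n p)), mem_QS hp ?_, ?_, ?_⟩
  · refine le_trans (Finset.card_le_card ?_) hc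
    intro x; simp; tauto
  · intro x hx
    have a1 : x ∈ U1 ∪ D1 → x ∉ U2 ∪ D2 := fun h => Finset.disjoint_left.1 hd h
    have a2 : x ∈ U1 ∪ U2 → x ∉ D1 ∪ D2 := fun h => Finset.disjoint_left.1 hd1 h
    have a3 := h1 x
    simp only [Finset.mem_symmDiff, Finset.mem_union, Finset.mem_sdiff, Finset.mem_inter, Ini,
      Finset.mem_filter, Finset.mem_univ, true_and] at *
    by_cases hxp : x.val < p <;> simp only [hxp] <;> tauto
  · intro x hx
    have a1 : x ∈ U1 ∪ D1 → x ∉ U2 ∪ D2 := fun h => Finset.disjoint_left.1 hd h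
    have a2 : x ∈ U1 ∪ U2 → x ∉ D1 ∪ D2 := fun h => Finset.disjoint_left.1 hd1 h
    have a3 := h2 x
    rw [← not_lt] at a3
    simp only [Finset.mem_symmDiff, Finset.mem_union, Finset.mem_sdiff, Finset.mem_inter, Ini,
      Finset.mem_filter, Finset.mem_univ, true_and] at *
    by_cases hxp : x.val < p <;> simp only [hxp] <;> tauto

/-- `E` can be searched with cost at most `c`. -/
def Ach (s : ℕ) (μ : Fin n → ℝ) (E : Finset (Fin n)) (c : ℝ) : Prop :=
  ∃ T : DTree (Fin n), T.leaves.Nodup ∧ (∀ x, x ∈ T.leaves ↔ x ∈ E) ∧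
    (∀ x ∈ E, T.find? x = some (T.depth x)) ∧ T.questions ⊆ ↑(QS n s) ∧
    ∑ x ∈ E, μ x * (T.depth x : ℝ) ≤ c

lemma Ach.mono {s : ℕ} {μ : Fin n → ℝ} {E : Finset (Fin n)} {c c' : ℝ} (h : Ach s μ E c)
    (hc : c ≤ c') : Ach s μ E c' := by
  obtain ⟨T, h1, h2, h3, h4, h5⟩ := h
  exact ⟨T, h1, h2, h3, h4, h5.trans hc⟩

lemma ach_single (s : ℕ) (μ : Fin n → ℝ) (x : Fin n) : Ach s μ {x} 0 := by
  refine ⟨.leaf x, ?_, ?_, ?_, ?_, ?_⟩ <;>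
    simp [DTree.leaves, DTree.find?, DTree.depth, DTree.questions]

lemma Ach.node {s : ℕ} {μ : Fin n → ℝ} {E1 E2 q : Finset (Fin n)} {c1 c2 : ℝ}
    (h1 : Ach s μ E1 c1) (h2 : Ach s μ E2 c2) (hq : q ∈ QS n s)
    (hq1 : ∀ x ∈ E1, x ∈ q) (hq2 : ∀ x ∈ E2, x ∉ q) :
    Ach s μ (E1 ∪ E2) (c1 + c2 + ∑ x ∈ E1, μ x + ∑ x ∈ E2, μ x) := by
  obtain ⟨T1, a1, a2, a3, a4, a5⟩ := h1
  obtain ⟨T2, b1, b2, b3, b4, b5⟩ := h2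
  have hd : Disjoint E1 E2 := Finset.disjoint_left.2 fun x hx hx' => hq2 x hx' (hq1 x hx)
  have f1 : ∀ x ∈ E1, (DTree.node q T1 T2).find? x = some (T1.depth x + 1) := by
    intro x hx; simp [DTree.find?, hq1 x hx, a3 x hx]
  have f2 : ∀ x ∈ E2, (DTree.node q T1 T2).find? x = some (T2.depth x + 1) := by
    intro x hx; simp [DTree.find?, hq2 x hx, b3 x hx]
  have g1 : ∀ x ∈ E1, (DTree.node q T1 T2).depth x = T1.depth x + 1 := by
    intro x hx; rw [DTree.depth, f1 x hx]; rfl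
  have g2 : ∀ x ∈ E2, (DTree.node q T1 T2).depth x = T2.depth x + 1 := by
    intro x hx; rw [DTree.depth, f2 x hx]; rfl
  refine ⟨.node q T1 T2, ?_, ?_, ?_, ?_, ?_⟩
  · rw [DTree.leaves, List.nodup_append]
    refine ⟨a1, b1, ?_⟩
    intro x hx y hy hxy
    subst hxy
    exact Finset.disjoint_left.1 hd ((a2 x).1 hx) ((b2 x).1 hy)
  · intro x; simp [DTree.leaves, a2, b2]
  · intro x hx
    rcases Finset.mem_union.1 hx with h | h
    · rw [f1 x h, g1 x h]
    · rw [f2 x h, g2 x h]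
  · rw [DTree.questions]
    exact Set.insert_subset hq (Set.union_subset a4 b4)
  · rw [Finset.sum_union hd]
    have e1 : ∑ x ∈ E1, μ x * ((DTree.node q T1 T2).depth x : ℝ)
        = ∑ x ∈ E1, μ x * (T1.depth x : ℝ) + ∑ x ∈ E1, μ x := by
      rw [← Finset.sum_add_distrib]
      refine Finset.sum_congr rfl fun x hx => ?_
      rw [g1 x hx]; push_cast; ring
    have e2 : ∑ x ∈ E2, μ x * ((DTree.node q T1 T2).depth x : ℝ)
        = ∑ x ∈ E2, μ x * (T2.depth x : ℝ) + ∑ x ∈ E2, μ x := by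
      rw [← Finset.sum_add_distrib]
      refine Finset.sum_congr rfl fun x hx => ?_
      rw [g2 x hx]; push_cast; ring
    rw [e1, e2]; linarith

/-- Cost bound of a configuration. -/
noncomputable def CC (μ : Fin n → ℝ) (ρ : ℝ) (e : Fin n → Finset (Fin n)) (c : Fin n → ℝ)
    (g : Fin n → ℕ) (G : ℕ) (S D : Finset (Fin n)) : ℝ :=
  ∑ x ∈ S, (c x + (∑ y ∈ e x, μ y) * ((G : ℝ) - g x)) + ρ * ∑ x ∈ D, μ x

lemma CC_union {μ : Fin n → ℝ} {ρ : ℝ} {e : Fin n → Finset (Fin n)} {c : Fin n → ℝ}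
    {g : Fin n → ℕ} {G : ℕ} {S1 S2 D1 D2 : Finset (Fin n)} (hS : Disjoint S1 S2)
    (hD : Disjoint D1 D2) :
    CC μ ρ e c g (G+1) (S1 ∪ S2) (D1 ∪ D2) = CC μ ρ e c g G S1 D1 + CC μ ρ e c g G S2 D2
      + ∑ x ∈ S1, ∑ y ∈ e x, μ y + ∑ x ∈ S2, ∑ y ∈ e x, μ y := by
  unfold CC
  rw [Finset.sum_union hS, Finset.sum_union hD]
  have : ∀ S : Finset (Fin n), ∑ x ∈ S, (c x + (∑ y ∈ e x, μ y) * (((G+1 : ℕ) : ℝ) - g x))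
      = ∑ x ∈ S, (c x + (∑ y ∈ e x, μ y) * ((G : ℝ) - g x)) + ∑ x ∈ S, ∑ y ∈ e x, μ y := by
    intro S
    rw [← Finset.sum_add_distrib]
    refine Finset.sum_congr rfl fun x hx => ?_
    push_cast; ring
  rw [this, this]; ring

lemma combine {s : ℕ} {μ : Fin n → ℝ} (hμ : ∀ x, 0 ≤ μ x) {ρ : ℝ}
    {e : Fin n → Finset (Fin n)} {c : Fin n → ℝ}
    {g : Fin n → ℕ} {G p : ℕ} (hp : p ≤ n) {B1 B2 D1 D2 : Finset (Fin n)}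
    (hdis : (↑((B1 ∪ D1) ∪ (B2 ∪ D2)) : Set (Fin n)).PairwiseDisjoint e)
    (hB : Disjoint B1 B2) (hD : Disjoint D1 D2) (hBD : Disjoint (B1 ∪ B2) (D1 ∪ D2))
    (hcard : ∑ x ∈ B1 ∪ B2, (e x).card ≤ s)
    (he : ∀ x ∈ D1 ∪ D2, e x = {x})
    (h1 : ∀ x ∈ D1, x.val < p) (h2 : ∀ x ∈ D2, p ≤ x.val)
    (hne : ((B1 ∪ D1) ∪ (B2 ∪ D2)).Nonempty)
    (H1 : (B1 ∪ D1).Nonempty → Ach s μ ((B1 ∪ D1).biUnion e) (CC μ ρ e c g G (B1 ∪ D1) D1))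
    (H2 : (B2 ∪ D2).Nonempty → Ach s μ ((B2 ∪ D2).biUnion e) (CC μ ρ e c g G (B2 ∪ D2) D2)) :
    Ach s μ (((B1 ∪ D1) ∪ (B2 ∪ D2)).biUnion e)
      (CC μ ρ e c g (G+1) ((B1 ∪ D1) ∪ (B2 ∪ D2)) (D1 ∪ D2)) := by
  classical
  have hS : Disjoint (B1 ∪ D1) (B2 ∪ D2) := by
    rw [Finset.disjoint_left] at *
    intro x; have := @hB x; have := @hD x; have := @hBD x
    simp only [Finset.mem_union] at *
    tauto
  have mnn : ∀ S : Finset (Fin n), 0 ≤ ∑ x ∈ S, ∑ y ∈ e x, μ y := fun S =>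
    Finset.sum_nonneg fun x _ => Finset.sum_nonneg fun y _ => hμ y
  have hcc := CC_union (μ := μ) (ρ := ρ) (e := e) (c := c) (g := g) (G := G) hS hD
  rcases (B1 ∪ D1).eq_empty_or_nonempty with k1 | k1
  · have k2 : (B2 ∪ D2).Nonempty := by rwa [k1, Finset.empty_union] at hne
    have kD : D1 = ∅ := (Finset.union_eq_empty.1 k1).2
    have := H2 k2
    rw [hcc]
    rw [k1, Finset.empty_union]
    refine this.mono ?_
    have := mnn (B2 ∪ D2)
    simp [CC, kD] at *
    linarith
  rcases (B2 ∪ D2).eq_empty_or_nonempty with k2 | k2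
  · have kD : D2 = ∅ := (Finset.union_eq_empty.1 k2).2
    have := H1 k1
    rw [hcc]
    rw [k2, Finset.union_empty]
    refine this.mono ?_
    have := mnn (B1 ∪ D1)
    simp [CC, kD] at *
    linarith
  have bi : ∀ D : Finset (Fin n), D ⊆ D1 ∪ D2 → D.biUnion e = D := by
    intro D hD
    ext x
    simp only [Finset.mem_biUnion]
    constructor
    · rintro ⟨y, hy, hx⟩
      rw [he y (hD hy)] at hx
      rw [Finset.mem_singleton.1 hx]; exact hy
    · intro hx; exact ⟨x, hx, by rw [he x (hD hx)]; simp⟩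
  have sub1 : ∀ {X Y : Finset (Fin n)}, X ⊆ (B1 ∪ D1) ∪ (B2 ∪ D2) → Y ⊆ (B1 ∪ D1) ∪ (B2 ∪ D2) →
      Disjoint X Y → Disjoint (X.biUnion e) (Y.biUnion e) := by
    intro X Y hX hY hXY
    rw [Finset.disjoint_biUnion_left]
    intro i hi
    rw [Finset.disjoint_biUnion_right]
    intro j hj
    refine hdis (Finset.mem_coe.2 (hX hi)) (Finset.mem_coe.2 (hY hj)) ?_
    rintro rfl
    exact Finset.disjoint_left.1 hXY hi hj
  obtain ⟨q, hq, hq1, hq2⟩ := sep_exists (s := s) hp (U1 := B1.biUnion e) (U2 := B2.biUnion e)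
    (D1 := D1) (D2 := D2)
    (by rw [← Finset.union_biUnion]; exact Finset.card_biUnion_le.trans hcard)
    (by
      have := sub1 (X := B1 ∪ D1) (Y := B2 ∪ D2) Finset.subset_union_left
        Finset.subset_union_right hS
      rwa [Finset.union_biUnion, Finset.union_biUnion, bi D1 Finset.subset_union_left,
        bi D2 Finset.subset_union_right] at this) h1 h2
    (by
      have := sub1 (X := B1 ∪ B2) (Y := D1 ∪ D2) (by intro x; simp; tauto)
        (by intro x; simp; tauto) hBD
      rwa [bi _ (Finset.Subset.refl _), Finset.union_biUnion] at this)
  have := (H1 k1).node (H2 k2) hq (by rwa [Finset.union_biUnion, bi D1 Finset.subset_union_left])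
    (by rwa [Finset.union_biUnion, bi D2 Finset.subset_union_right])
  rw [← Finset.union_biUnion] at this
  refine this.mono ?_
  rw [hcc, Finset.sum_biUnion, Finset.sum_biUnion]
  · intro i hi j hj hij
    exact hdis (Finset.mem_coe.2 (Finset.mem_union_right _ hi)) (Finset.mem_coe.2 (Finset.mem_union_right _ hj)) hij
  · intro i hi j hj hij
    exact hdis (Finset.mem_coe.2 (Finset.mem_union_left _ hi)) (Finset.mem_coe.2 (Finset.mem_union_left _ hj)) hij

/-- Balanced split. -/
lemma balance {ι : Type*} [DecidableEq ι] (w : ι → ℕ) (B : Finset ι) (hw : ∀ x ∈ B, w x ≤ 2) :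
    ∃ B1 B2 : Finset ι, B1 ∪ B2 = B ∧ Disjoint B1 B2 ∧ ∑ x ∈ B1, w x ≤ ∑ x ∈ B2, w x + 2 ∧
      ∑ x ∈ B2, w x ≤ ∑ x ∈ B1, w x + 2 := by
  induction B using Finset.induction_on with
  | empty => exact ⟨∅, ∅, by simp⟩
  | insert a B ha ih =>
    obtain ⟨B1, B2, h1, h2, h3, h4⟩ := ih fun x hx => hw x (Finset.mem_insert_of_mem hx)
    have ha1 : a ∉ B1 := fun h => ha (h1 ▸ Finset.mem_union_left _ h)
    have ha2 : a ∉ B2 := fun h => ha (h1 ▸ Finset.mem_union_right _ h)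
    have := hw a (Finset.mem_insert_self _ _)
    rcases le_total (∑ x ∈ B1, w x) (∑ x ∈ B2, w x) with h | h
    · refine ⟨insert a B1, B2, by rw [Finset.insert_union, h1], by simp [ha2, h2], ?_, ?_⟩ <;>
        rw [Finset.sum_insert ha1] <;> omega
    · refine ⟨B1, insert a B2, by rw [Finset.union_insert, h1], by simp [ha1, h2], ?_, ?_⟩ <;>
        rw [Finset.sum_insert ha2] <;> omega

lemma exact_sub {ι : Type*} [DecidableEq ι] (g : ι → ℕ) (m : ℕ) (B : Finset ι)
    (hg : ∀ x ∈ B, g x ≤ m) (hs : 2 ^ m ≤ ∑ x ∈ B, 2 ^ g x) :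
    ∃ B1 ⊆ B, ∑ x ∈ B1, 2 ^ g x = 2 ^ m := by
  induction hk : B.card generalizing B with
  | zero =>
    rw [Finset.card_eq_zero.1 hk] at hs; simp at hs
  | succ k ih =>
    have hne : B.Nonempty := by rw [← Finset.card_pos]; omega
    obtain ⟨i, hi, hmin⟩ := Finset.exists_min_image B g hne
    have hsum := Finset.add_sum_erase B (fun x => 2 ^ g x) hi
    by_cases hc : 2 ^ m ≤ ∑ x ∈ B.erase i, 2 ^ g x
    · obtain ⟨B1, h1, h2⟩ := ih (B.erase i) (fun x hx => hg x (Finset.mem_of_mem_erase hx)) hc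
        (by rw [Finset.card_erase_of_mem hi, hk]; rfl)
      exact ⟨B1, h1.trans (Finset.erase_subset _ _), h2⟩
    · refine ⟨B, Finset.Subset.refl _, ?_⟩
      have d1 : 2 ^ g i ∣ ∑ x ∈ B, 2 ^ g x :=
        Finset.dvd_sum fun x hx => pow_dvd_pow 2 (hmin x hx)
      have d2 : 2 ^ g i ∣ 2 ^ m := pow_dvd_pow 2 (hg i hi)
      have d3 := Nat.dvd_sub d1 d2
      have : ∑ x ∈ B, 2 ^ g x - 2 ^ m = 0 := Nat.eq_zero_of_dvd_of_lt d3 (by omega)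
      omega

lemma top_sub {ι : Type*} [DecidableEq ι] (g : ι → ℕ) (D : Finset ι) (m : ℕ) (hm : m ≤ D.card) :
    ∃ N ⊆ D, N.card = m ∧ ∀ y ∈ N, ∀ z ∈ D \ N, g z ≤ g y := by
  induction m with
  | zero => exact ⟨∅, by simp, by simp, by simp⟩
  | succ m ih =>
    obtain ⟨N, h1, h2, h3⟩ := ih (by omega)
    have hne : (D \ N).Nonempty := by
      rw [← Finset.card_pos, Finset.card_sdiff_of_subset h1]; omega
    obtain ⟨a, ha, hmax⟩ := Finset.exists_max_image (D \ N) g hne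
    have ha' := Finset.mem_sdiff.1 ha
    refine ⟨insert a N, Finset.insert_subset ha'.1 h1, by rw [Finset.card_insert_of_notMem ha'.2, h2], ?_⟩
    intro y hy z hz
    have hz' : z ∈ D \ N := by
      simp at hz ⊢; tauto
    rcases Finset.mem_insert.1 hy with rfl | hy
    · exact hmax z hz'
    · exact h3 y hy z hz'

lemma two_min {ι : Type*} [DecidableEq ι] (μ : ι → ℝ) (N : Finset ι) (hN : 2 ≤ N.card) :
    ∃ a ∈ N, ∃ b ∈ N, a ≠ b ∧ μ a + μ b ≤ 2 / (N.card : ℝ) * ∑ x ∈ N, μ x := by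
  obtain ⟨b, hb, hbm⟩ := Finset.exists_min_image N μ (Finset.card_pos.1 (by omega))
  have hc := Finset.card_erase_of_mem hb
  obtain ⟨a, ha, ham⟩ := Finset.exists_min_image (N.erase b) μ (Finset.card_pos.1 (by omega))
  refine ⟨a, Finset.mem_of_mem_erase ha, b, hb, Finset.ne_of_mem_erase ha, ?_⟩
  have h1 := Finset.card_nsmul_le_sum (N.erase b) μ (μ a) ham
  have h2 := Finset.add_sum_erase N μ hb
  have h3 := hbm a (Finset.mem_of_mem_erase ha)
  have h4 : (2:ℝ) ≤ N.card := by exact_mod_cast hN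
  rw [hc, nsmul_eq_mul, Nat.cast_sub (by omega)] at h1
  push_cast at h1
  rw [div_mul_eq_mul_div, le_div_iff₀ (by linarith)]
  nlinarith

lemma prefix_split (g : Fin n → ℕ) (D : Finset (Fin n)) (h C1 C2 : ℕ) (hg : ∀ x ∈ D, g x ≤ h)
    (hs : ∑ x ∈ D, 2 ^ g x + 2 ^ h ≤ C1 + C2) :
    ∃ p ≤ n, ∑ x ∈ D.filter (fun x => x.val < p), 2 ^ g x ≤ C1 ∧
      ∑ x ∈ D.filter (fun x => ¬ x.val < p), 2 ^ g x ≤ C2 := by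
  have key : ∀ p ≤ n, ∑ x ∈ D.filter (fun x => x.val < p), 2 ^ g x ≤ C1 ∨ 
      ∃ p ≤ n, ∑ x ∈ D.filter (fun x => x.val < p), 2 ^ g x ≤ C1 ∧
      ∑ x ∈ D.filter (fun x => ¬ x.val < p), 2 ^ g x ≤ C2 := by
    intro p
    induction p with
    | zero => intro _; left; simp
    | succ p ih =>
      intro hp
      rcases ih (by omega) with h1 | h1
      · by_cases h2 : ∑ x ∈ D.filter (fun x => x.val < p+1), 2 ^ g x ≤ C1
        · exact Or.inl h2
        · right
          refine ⟨p, by omega, h1, ?_⟩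
          have e1 := Finset.sum_filter_add_sum_filter_not D (fun x => x.val < p) (fun x => 2 ^ g x)
          have e2 : ∑ x ∈ D.filter (fun x => x.val < p+1), 2 ^ g x ≤
              ∑ x ∈ D.filter (fun x => x.val < p), 2 ^ g x + 2 ^ h := by
            by_cases hpD : (⟨p, by omega⟩ : Fin n) ∈ D
            · have : D.filter (fun x => x.val < p+1) =
                  insert (⟨p, by omega⟩ : Fin n) (D.filter (fun x => x.val < p)) := by
                ext x
                simp only [Finset.mem_filter, Finset.mem_insert, Fin.ext_iff]
                constructor
                · rintro ⟨a, b⟩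
                  by_cases x.val = p
                  · left; assumption
                  · right; exact ⟨a, by omega⟩
                · rintro (a | a)
                  · refine ⟨?_, by omega⟩
                    convert hpD
                  · exact ⟨a.1, by omega⟩
              rw [this, Finset.sum_insert (by simp)]
              have := Nat.pow_le_pow_right (n := 2) (by norm_num) (hg _ hpD)
              omega
            · have : D.filter (fun x => x.val < p+1) = D.filter (fun x => x.val < p) := by
                ext x
                simp only [Finset.mem_filter]
                constructor
                · rintro ⟨a, b⟩
                  refine ⟨a, ?_⟩
                  have : x.val ≠ p := by
                    intro hx; apply hpD; convert a; exact hx.symm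
                  omega
                · rintro ⟨a, b⟩; exact ⟨a, by omega⟩
              rw [this]; exact Nat.le_add_right _ _
          omega
      · exact Or.inr h1
  rcases key n le_rfl with h1 | h1
  · refine ⟨n, le_rfl, h1, ?_⟩
    have : D.filter (fun x => ¬ x.val < n) = ∅ := by
      ext x; simp
    rw [this]; simp
  · exact h1

end aux
end TQ
namespace TQ
section main
variable {n : ℕ}

structure Cfg (s : ℕ) (μ : Fin n → ℝ) (e : Fin n → Finset (Fin n)) (c : Fin n → ℝ)
    (B D : Finset (Fin n)) : Prop where
  disj : Disjoint B D
  pw : (↑(B ∪ D) : Set (Fin n)).PairwiseDisjoint e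
  ach : ∀ x ∈ B, Ach s μ (e x) (c x)
  card : ∀ x ∈ B, (e x).card ≤ 2
  eD : ∀ x ∈ D, e x = {x}
  cD : ∀ x ∈ D, c x = 0

lemma Cfg.sub {s : ℕ} {μ : Fin n → ℝ} {e : Fin n → Finset (Fin n)} {c : Fin n → ℝ}
    {B D B' D' : Finset (Fin n)} (h : Cfg s μ e c B D) (hB : B' ⊆ B) (hD : D' ⊆ D) :
    Cfg s μ e c B' D' where
  disj := Finset.disjoint_of_subset_left hB (Finset.disjoint_of_subset_right hD h.disj)
  pw := h.pw.subset (by exact_mod_cast Finset.union_subset_union hB hD)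
  ach := fun x hx => h.ach x (hB hx)
  card := fun x hx => h.card x (hB hx)
  eD := fun x hx => h.eD x (hD hx)
  cD := fun x hx => h.cD x (hD hx)

def P1 (M : ℕ) (μ : Fin n → ℝ) (ρ : ℝ) (G : ℕ) : Prop :=
  ∀ (e : Fin n → Finset (Fin n)) (c : Fin n → ℝ) (g : Fin n → ℕ) (B D : Finset (Fin n)),
    Cfg (2*M) μ e c B D → (B ∪ D).Nonempty → ∑ x ∈ B, (e x).card ≤ M + 1 →
    ∑ x ∈ B, 2 ^ g x + ∑ x ∈ D, 2 ^ g x ≤ 2 ^ G →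
    Ach (2*M) μ ((B ∪ D).biUnion e) (CC μ ρ e c g G (B ∪ D) D)

def P2 (M : ℕ) (μ : Fin n → ℝ) (ρ : ℝ) (G : ℕ) : Prop :=
  ∀ (e : Fin n → Finset (Fin n)) (c : Fin n → ℝ) (g : Fin n → ℕ) (B D : Finset (Fin n)),
    Cfg (2*M) μ e c B D → (B ∪ D).Nonempty → ∑ x ∈ B, (e x).card ≤ 2 * M →
    ∑ x ∈ B, 2 ^ g x + ∑ x ∈ D, 2 ^ g x ≤ 2 ^ G →
    (D = ∅ ∨ ∃ h, (∀ x ∈ D, g x ≤ h) ∧ ∑ x ∈ B, 2 ^ g x + ∑ x ∈ D, 2 ^ g x + 2 ^ h ≤ 2 ^ G) →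
    Ach (2*M) μ ((B ∪ D).biUnion e) (CC μ ρ e c g G (B ∪ D) D)

lemma P1_of_P2 {M : ℕ} (hM : 3 ≤ M) {μ : Fin n → ℝ} (hμ : ∀ x, 0 ≤ μ x) {ρ : ℝ}
    (hρ : ρ = 2 / ((M : ℝ) - 1)) {G : ℕ} (H : P2 M μ ρ G) : P1 M μ ρ G := by
  classical
  intro e c g B D hC hne hw hs
  have hρ0 : 0 ≤ ρ := by
    rw [hρ]
    have : (3:ℝ) ≤ M := by exact_mod_cast hM
    apply div_nonneg <;> linarith
  by_cases hDc : D.card ≤ M - 1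
  · -- explicit
    have hC' : Cfg (2*M) μ e c (B ∪ D) ∅ :=
      { disj := by simp
        pw := by simpa using hC.pw
        ach := by
          intro x hx
          rcases Finset.mem_union.1 hx with h | h
          · exact hC.ach x h
          · rw [hC.eD x h, hC.cD x h]; exact ach_single _ _ _
        card := by
          intro x hx
          rcases Finset.mem_union.1 hx with h | h
          · exact hC.card x h
          · rw [hC.eD x h]; simp
        eD := by simp
        cD := by simp }
    have := H e c g (B ∪ D) ∅ hC' (by simpa using hne) (by
        rw [Finset.sum_union hC.disj]
        have : ∑ x ∈ D, (e x).card = D.card := by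
          rw [Finset.sum_congr rfl (fun x hx => by rw [hC.eD x hx, Finset.card_singleton])]; simp
        omega) (by rw [Finset.sum_union hC.disj]; simpa using hs) (Or.inl rfl)
    rw [Finset.union_empty] at this
    refine this.mono ?_
    unfold CC
    have : 0 ≤ ρ * ∑ x ∈ D, μ x := mul_nonneg hρ0 (Finset.sum_nonneg fun x _ => hμ x)
    simp only [Finset.sum_empty, mul_zero]
    linarith
  · obtain ⟨N, hND, hNc, hNtop⟩ := top_sub g D (M-1) (by omega)
    obtain ⟨a, ha, b, hb, hab, hmin⟩ : ∃ a ∈ N, ∃ b ∈ N, a ≠ b ∧ (g b ≤ g a ∧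
        μ a + μ b ≤ ρ * ∑ x ∈ N, μ x) := by
      obtain ⟨a, ha, b, hb, hab, hmin⟩ := two_min μ N (by omega)
      rw [hNc, Nat.cast_sub (by omega), Nat.cast_one, ← hρ] at hmin
      rcases le_total (g b) (g a) with h | h
      · exact ⟨a, ha, b, hb, hab, h, hmin⟩
      · exact ⟨b, hb, a, ha, hab.symm, h, by linarith⟩
    obtain ⟨hgab, hmin⟩ := hmin
    have hBN : Disjoint B N := Finset.disjoint_of_subset_right hND hC.disj
    have haB : a ∉ B := Finset.disjoint_right.1 hBN ha
    have hbB : b ∉ B := Finset.disjoint_right.1 hBN hb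
    -- decompose
    set R := (N.erase b).erase a with hR
    have haNb : a ∈ N.erase b := Finset.mem_erase.2 ⟨hab, ha⟩
    have hRN : R ⊆ N := (Finset.erase_subset _ _).trans (Finset.erase_subset _ _)
    have haR : a ∉ R := by simp [hR]
    have hbR : b ∉ R := by simp [hR]
    have haD' : a ∉ D \ N := by simp [ha]
    have hbD' : b ∉ D \ N := by simp [hb]
    have sumN : ∀ {β : Type} [AddCommMonoid β] (f : Fin n → β), ∑ x ∈ N, f x = f b + (f a + ∑ x ∈ R, f x) := by
      intro β _ f
      rw [← Finset.add_sum_erase N f hb, ← Finset.add_sum_erase _ f haNb]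
    have sumD : ∀ {β : Type} [AddCommMonoid β] (f : Fin n → β), ∑ x ∈ D, f x = ∑ x ∈ D \ N, f x + ∑ x ∈ N, f x := by
      intro β _ f
      rw [Finset.sum_sdiff hND]
    have hBR : Disjoint B R := Finset.disjoint_of_subset_right hRN hBN
    have haBR : a ∉ B ∪ R := by simp [haB, haR]
    set B' := insert a (B ∪ R) with hB'
    have sumB' : ∀ {β : Type} [AddCommMonoid β] (f : Fin n → β), ∑ x ∈ B', f x = f a + (∑ x ∈ B, f x + ∑ x ∈ R, f x) := by
      intro β _ f
      rw [hB', Finset.sum_insert haBR, Finset.sum_union hBR]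
    set e' := Function.update e a {a, b} with he'
    set c' := Function.update c a (μ a + μ b) with hc'
    have e'a : e' a = {a, b} := by simp [he']
    have c'a : c' a = μ a + μ b := by simp [hc']
    have e'x : ∀ x, x ≠ a → e' x = e x := fun x hx => by simp [he', hx]
    have c'x : ∀ x, x ≠ a → c' x = c x := fun x hx => by simp [hc', hx]
    have neB : ∀ x ∈ B, x ≠ a := fun x hx h => haB (h ▸ hx)
    have neR : ∀ x ∈ R, x ≠ a := fun x hx h => haR (h ▸ hx)
    have neD : ∀ x ∈ D \ N, x ≠ a := fun x hx h => haD' (h ▸ hx)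
    have eR : ∀ x ∈ R, e x = {x} := fun x hx => hC.eD x (hND (hRN hx))
    have ea : e a = {a} := hC.eD a (hND ha)
    have eb : e b = {b} := hC.eD b (hND hb)
    have ca : c a = 0 := hC.cD a (hND ha)
    have cb : c b = 0 := hC.cD b (hND hb)
    have hsub : B' ∪ (D \ N) ⊆ B ∪ D := by
      intro x hx
      simp only [hB', Finset.mem_union, Finset.mem_insert, Finset.mem_sdiff] at hx ⊢
      rcases hx with (rfl | h | h) | h
      · right; exact hND ha
      · left; exact h
      · right; exact hND (hRN h)
      · right; exact h.1
    have hbS : b ∉ B' ∪ (D \ N) := by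
      simp only [hB', Finset.mem_union, Finset.mem_insert, not_or]
      exact ⟨⟨hab.symm, hbB, hbR⟩, hbD'⟩
    have hins : B ∪ D = insert b (B' ∪ (D \ N)) := by
      apply Finset.Subset.antisymm
      · intro x hx
        simp only [hB', hR, Finset.mem_union, Finset.mem_insert, Finset.mem_sdiff, Finset.mem_erase] at hx ⊢
        tauto
      · exact Finset.insert_subset (Finset.mem_union_right _ (hND hb)) hsub
    have achab : Ach (2*M) μ {a, b} (μ a + μ b) := by
      obtain ⟨q, hq, hq1, hq2⟩ := sep_exists (s := 2*M) (p := 0) (Nat.zero_le n) (U1 := {a}) (U2 := {b})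
        (D1 := ∅) (D2 := ∅) ((Finset.card_union_le _ _).trans (by simp; omega)) (by simpa using hab)
        (by simp) (by simp) (by simp)
      have := (ach_single (2*M) μ a).node (ach_single (2*M) μ b) hq (by simpa using hq1)
        (by simpa using hq2)
      refine (this.mono ?_ : Ach (2*M) μ ({a} ∪ {b}) (μ a + μ b))
      simp
    have e'un : ∀ x ∈ B' ∪ (D \ N), e' x ⊆ if x = a then e a ∪ e b else e x := by
      intro x hx
      split_ifs with h
      · rw [h, e'a, ea, eb]; rfl
      · rw [e'x x h]
    have hC' : Cfg (2*M) μ e' c' B' (D \ N) :=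
      { disj := by
          rw [hB', Finset.disjoint_insert_left]
          refine ⟨haD', Finset.disjoint_union_left.2 ⟨?_, ?_⟩⟩
          · exact Finset.disjoint_of_subset_right Finset.sdiff_subset hC.disj
          · exact Finset.disjoint_of_subset_left hRN Finset.disjoint_sdiff
        pw := by
          intro x hx y hy hxy
          have hx := Finset.mem_coe.1 hx
          have hy := Finset.mem_coe.1 hy
          have hxb : x ≠ b := fun h => hbS (h ▸ hx)
          have hyb : y ≠ b := fun h => hbS (h ▸ hy)
          have key : ∀ u ∈ B ∪ D, ∀ v ∈ B ∪ D, u ≠ v → Disjoint (e u) (e v) := fun u hu v hv huv =>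
            hC.pw (Finset.mem_coe.2 hu) (Finset.mem_coe.2 hv) huv
          have haM := Finset.mem_union_right B (hND ha)
          have hbM := Finset.mem_union_right B (hND hb)
          refine Finset.disjoint_of_subset_left (e'un x hx)
            (Finset.disjoint_of_subset_right (e'un y hy) ?_)
          by_cases h1 : x = a
          · have h2 : y ≠ a := fun h => hxy (h1.trans h.symm)
            rw [if_pos h1, if_neg h2, Finset.disjoint_union_left]
            exact ⟨key _ haM _ (hsub hy) h2.symm, key _ hbM _ (hsub hy) hyb.symm⟩
          · by_cases h2 : y = a
            · rw [if_neg h1, if_pos h2, Finset.disjoint_union_right]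
              exact ⟨key _ (hsub hx) _ haM h1, key _ (hsub hx) _ hbM hxb⟩
            · rw [if_neg h1, if_neg h2]
              exact key _ (hsub hx) _ (hsub hy) hxy
        ach := by
          intro x hx
          rcases Finset.mem_insert.1 hx with rfl | hx
          · rw [e'a, c'a]; exact achab
          · rcases Finset.mem_union.1 hx with h | h
            · rw [e'x x (neB x h), c'x x (neB x h)]; exact hC.ach x h
            · rw [e'x x (neR x h), c'x x (neR x h), eR x h, hC.cD x (hND (hRN h))]
              exact ach_single _ _ _
        card := by
          intro x hx
          rcases Finset.mem_insert.1 hx with rfl | hx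
          · rw [e'a]; exact Finset.card_le_two
          · rcases Finset.mem_union.1 hx with h | h
            · rw [e'x x (neB x h)]; exact hC.card x h
            · rw [e'x x (neR x h), eR x h]; simp
        eD := fun x hx => by
          rw [e'x x (neD x hx)]; exact hC.eD x (Finset.mem_sdiff.1 hx).1
        cD := fun x hx => by
          rw [c'x x (neD x hx)]; exact hC.cD x (Finset.mem_sdiff.1 hx).1 }
    have hcB : ∑ x ∈ B, (e' x).card = ∑ x ∈ B, (e x).card :=
      Finset.sum_congr rfl fun x hx => by rw [e'x x (neB x hx)]
    have hcR : ∑ x ∈ R, (e' x).card = R.card := by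
      rw [Finset.sum_congr rfl (fun x hx => by rw [e'x x (neR x hx), eR x hx, Finset.card_singleton])]
      simp
    have hRc : R.card + 2 = M - 1 := by
      rw [hR, Finset.card_erase_of_mem haNb, Finset.card_erase_of_mem hb]; omega
    have g1 := sumD (fun x => 2 ^ g x)
    have g2 := sumN (fun x => 2 ^ g x)
    have g3 := sumB' (fun x => 2 ^ g x)
    have g4 := Nat.two_pow_pos (g b)
    have := H e' c' g B' (D \ N) hC' ⟨a, by simp [hB']⟩ (by
        rw [sumB', e'a, Finset.card_pair hab, hcB, hcR]; omega)
      (by omega)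
      (Or.inr ⟨g b, fun x hx => hNtop b hb x hx, by omega⟩)
    have hset : (B ∪ D).biUnion e = (B' ∪ (D \ N)).biUnion e' := by
      rw [hins]
      ext y
      simp only [Finset.mem_biUnion, Finset.mem_insert]
      constructor
      · rintro ⟨x, rfl | hx, hy⟩
        · refine ⟨a, by simp [hB'], ?_⟩
          rw [e'a]; rw [eb] at hy; simp at hy ⊢; exact Or.inr hy
        · refine ⟨x, hx, ?_⟩
          by_cases h : x = a
          · subst h; rw [e'a]; rw [ea] at hy; simp at hy ⊢; exact Or.inl hy
          · rwa [e'x x h]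
      · rintro ⟨x, hx, hy⟩
        by_cases h : x = a
        · subst h
          rw [e'a] at hy
          simp at hy
          rcases hy with rfl | rfl
          · exact ⟨y, Or.inr hx, by rw [ea]; simp⟩
          · exact ⟨y, Or.inl rfl, by rw [eb]; simp⟩
        · exact ⟨x, Or.inr hx, by rwa [e'x x h] at hy⟩
    rw [hset]
    refine this.mono ?_
    unfold CC
    rw [Finset.sum_union hC'.disj, Finset.sum_union hC.disj, sumB', sumD, sumN, sumD μ, e'a, c'a,
      Finset.sum_pair hab, ea, eb, ca, cb, Finset.sum_singleton, Finset.sum_singleton]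
    have q1 : ∀ S : Finset (Fin n), (∀ x ∈ S, x ≠ a) →
        ∑ x ∈ S, (c' x + (∑ y ∈ e' x, μ y) * ((G : ℝ) - g x)) =
        ∑ x ∈ S, (c x + (∑ y ∈ e x, μ y) * ((G : ℝ) - g x)) := fun S hS =>
      Finset.sum_congr rfl fun x hx => by rw [e'x x (hS x hx), c'x x (hS x hx)]
    rw [q1 B neB, q1 R neR, q1 _ neD]
    have q2 : μ b * (g b : ℝ) ≤ μ b * (g a : ℝ) :=
      mul_le_mul_of_nonneg_left (by exact_mod_cast hgab) (hμ b)
    nlinarith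

lemma sum_pow_zero {g : Fin n → ℕ} {S : Finset (Fin n)} (h : ∑ x ∈ S, 2 ^ g x = 0) : S = ∅ := by
  by_contra hS
  obtain ⟨x, hx⟩ := Finset.nonempty_iff_ne_empty.2 hS
  have := Finset.sum_eq_zero_iff.1 h x hx
  simp at this

lemma P2_single {M : ℕ} {μ : Fin n → ℝ} {ρ : ℝ} {G : ℕ}
    {e : Fin n → Finset (Fin n)} {c : Fin n → ℝ} {g : Fin n → ℕ} {B D : Finset (Fin n)}
    (hC : Cfg (2*M) μ e c B D) (hs : ∑ x ∈ B, 2 ^ g x + ∑ x ∈ D, 2 ^ g x ≤ 2 ^ G)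
    {x : Fin n} (hx : x ∈ B) (hg : G ≤ g x) :
    Ach (2*M) μ ((B ∪ D).biUnion e) (CC μ ρ e c g G (B ∪ D) D) := by
  classical
  have h1 := Finset.add_sum_erase B (fun x => 2 ^ g x) hx
  have h2 : 2 ^ G ≤ 2 ^ g x := Nat.pow_le_pow_right (by norm_num) hg
  have hD : D = ∅ := sum_pow_zero (g := g) (by omega)
  have hB : B.erase x = ∅ := sum_pow_zero (g := g) (by omega)
  have hB' : B = {x} := by
    rw [← Finset.insert_erase hx, hB]; rfl
  have h3 : g x ≤ G := by
    have : 2 ^ g x ≤ 2 ^ G := by omega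
    exact (Nat.pow_le_pow_iff_right (by norm_num)).1 this
  have h4 : g x = G := le_antisymm h3 hg
  subst hD
  rw [hB']
  simp only [Finset.union_empty, Finset.singleton_biUnion]
  refine (hC.ach x hx).mono ?_
  simp [CC, h4]

lemma P2_all {M : ℕ} (hM : 3 ≤ M) {μ : Fin n → ℝ} (hμ : ∀ x, 0 ≤ μ x) {ρ : ℝ}
    (hρ : ρ = 2 / ((M : ℝ) - 1)) (G : ℕ) : P2 M μ ρ G := by
  classical
  induction G with
  | zero =>
    intro e c g B D hC hne hw hs hsl
    rcases B.eq_empty_or_nonempty with hB | ⟨x, hx⟩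
    · exfalso
      subst hB
      rw [Finset.empty_union] at hne
      rcases hsl with h | ⟨h, h1, h2⟩
      · exact hne.ne_empty h
      · have := Nat.two_pow_pos h
        exact hne.ne_empty (sum_pow_zero (g := g) (by omega))
    · exact P2_single hC hs hx (Nat.zero_le _)
  | succ G ih =>
    intro e c g B D hC hne hw hs hsl
    by_cases hbig : ∃ x ∈ B, G + 1 ≤ g x
    · obtain ⟨x, hx, hg⟩ := hbig
      exact P2_single hC hs hx hg
    push Not at hbig
    have h2G : 2 ^ (G+1) = 2 ^ G + 2 ^ G := by ring
    -- general finishing step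
    have fin : ∀ (p : ℕ), p ≤ n → ∀ B1 B2 D1 D2 : Finset (Fin n), B1 ∪ B2 = B → Disjoint B1 B2 →
        D1 ∪ D2 = D → Disjoint D1 D2 → (∀ x ∈ D1, x.val < p) → (∀ x ∈ D2, p ≤ x.val) →
        ((B1 ∪ D1).Nonempty → Ach (2*M) μ ((B1 ∪ D1).biUnion e) (CC μ ρ e c g G (B1 ∪ D1) D1)) →
        ((B2 ∪ D2).Nonempty → Ach (2*M) μ ((B2 ∪ D2).biUnion e) (CC μ ρ e c g G (B2 ∪ D2) D2)) →
        Ach (2*M) μ ((B ∪ D).biUnion e) (CC μ ρ e c g (G+1) (B ∪ D) D) := by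
      intro p hp B1 B2 D1 D2 hB hBd hD hDd h1 h2 H1 H2
      have heq : (B1 ∪ D1) ∪ (B2 ∪ D2) = B ∪ D := by
        rw [← hB, ← hD]; ext x; simp only [Finset.mem_union]; tauto
      have := combine (s := 2*M) hμ (ρ := ρ) (e := e) (c := c) (g := g) (G := G) hp
        (B1 := B1) (B2 := B2) (D1 := D1) (D2 := D2) (by rw [heq]; exact hC.pw) hBd hDd
        (by rw [hB, hD]; exact hC.disj) (by rw [hB]; exact hw) (by rw [hD]; exact hC.eD) h1 h2
        (by rw [heq]; exact hne) H1 H2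
      rwa [heq, hD] at this
    by_cases hhalf : 2 ^ G ≤ ∑ x ∈ B, 2 ^ g x
    · obtain ⟨B1, hB1, hsum⟩ := exact_sub g G B (fun x hx => by have := hbig x hx; omega) hhalf
      have hsd := Finset.sum_sdiff (f := fun x => 2 ^ g x) hB1
      have hsw := Finset.sum_sdiff (f := fun x => (e x).card) hB1
      refine fin 0 (Nat.zero_le _) B1 (B \ B1) ∅ D (Finset.union_sdiff_of_subset hB1)
        Finset.disjoint_sdiff (by simp) (by simp) (by simp) (by simp) ?_ ?_
      · intro hn
        refine ih e c g B1 ∅ (hC.sub hB1 (Finset.empty_subset _)) hn (by omega) ?_ (Or.inl rfl)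
        rw [hsum]; simp
      · intro hn
        refine ih e c g (B \ B1) D (hC.sub Finset.sdiff_subset (Finset.Subset.refl _)) hn (by omega)
          (by omega) ?_
        rcases hsl with h | ⟨h, h1, h2⟩
        · exact Or.inl h
        · exact Or.inr ⟨h, h1, by omega⟩
    · rcases hsl with h | ⟨h, h1, h2⟩
      · subst h
        refine fin 0 (Nat.zero_le _) ∅ B ∅ ∅ (by simp) (by simp) (by simp) (by simp) (by simp)
          (by simp) (by simp) ?_
        intro hn
        exact ih e c g B ∅ hC hn hw (by simp; omega) (Or.inl rfl)
      · have ih1 := P1_of_P2 hM hμ hρ ih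
        obtain ⟨B1, B2, hB, hBd, hb1, hb2⟩ := balance (fun x => (e x).card) B hC.card
        have hsd := Finset.sum_union (f := fun x => 2 ^ g x) hBd
        have hsw := Finset.sum_union (f := fun x => (e x).card) hBd
        rw [hB] at hsd hsw
        obtain ⟨p, hp, hp1, hp2⟩ := prefix_split g D h (2 ^ G - ∑ x ∈ B1, 2 ^ g x)
          (2 ^ G - ∑ x ∈ B2, 2 ^ g x) h1 (by omega)
        have hB1 : B1 ⊆ B := hB ▸ Finset.subset_union_left
        have hB2 : B2 ⊆ B := hB ▸ Finset.subset_union_right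
        refine fin p hp B1 B2 _ _ hB hBd (Finset.filter_union_filter_not_eq (fun x => x.val < p) D)
          (Finset.disjoint_filter_filter_not D D _) (by simp) (by simp) ?_ ?_
        · intro hn
          exact ih1 e c g B1 _ (hC.sub hB1 (Finset.filter_subset _ _)) hn (by omega) (by omega)
        · intro hn
          exact ih1 e c g B2 _ (hC.sub hB2 (Finset.filter_subset _ _)) hn (by omega) (by omega)

lemma kraft (T : DTree (Fin n)) : ∀ (E : Finset (Fin n)) (K : ℕ),
    (∀ x ∈ E, ∃ d ≤ K, T.find? x = some d) → ∑ x ∈ E, 2 ^ (K - T.depth x) ≤ 2 ^ K := by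
  induction T with
  | leaf y =>
    intro E K h
    have hE : E ⊆ {y} := by
      intro x hx
      obtain ⟨d, _, hd⟩ := h x hx
      simp only [DTree.find?] at hd
      split_ifs at hd with hyx
      simp [hyx]
    refine (Finset.sum_le_sum_of_subset hE).trans ?_
    simp only [Finset.sum_singleton]
    exact Nat.pow_le_pow_right (by norm_num) (Nat.sub_le _ _)
  | node q t f iht ihf =>
    intro E K h
    have h1 : ∀ x ∈ E.filter (· ∈ q), ∃ d, d + 1 ≤ K ∧ t.find? x = some d ∧
        (DTree.node q t f).depth x = t.depth x + 1 := by
      intro x hx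
      have hx := Finset.mem_filter.1 hx
      obtain ⟨d, hd, hd2⟩ := h x hx.1
      simp only [DTree.find?, hx.2, if_true, Option.map_eq_some_iff] at hd2
      obtain ⟨d', h3, h4⟩ := hd2
      exact ⟨d', by omega, h3, by simp [DTree.depth, DTree.find?, hx.2, h3]⟩
    have h2 : ∀ x ∈ E.filter (¬ · ∈ q), ∃ d, d + 1 ≤ K ∧ f.find? x = some d ∧
        (DTree.node q t f).depth x = f.depth x + 1 := by
      intro x hx
      have hx := Finset.mem_filter.1 hx
      obtain ⟨d, hd, hd2⟩ := h x hx.1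
      simp only [DTree.find?, hx.2, if_false, Option.map_eq_some_iff] at hd2
      obtain ⟨d', h3, h4⟩ := hd2
      exact ⟨d', by omega, h3, by simp [DTree.depth, DTree.find?, hx.2, h3]⟩
    rcases E.eq_empty_or_nonempty with rfl | ⟨x0, hx0⟩
    · simp
    obtain ⟨K, rfl⟩ : ∃ K', K = K' + 1 := by
      by_cases hq : x0 ∈ q
      · obtain ⟨d, hd, _⟩ := h1 x0 (by simp [hx0, hq])
        exact ⟨K - 1, by omega⟩
      · obtain ⟨d, hd, _⟩ := h2 x0 (by simp [hx0, hq])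
        exact ⟨K - 1, by omega⟩
    rw [← Finset.sum_filter_add_sum_filter_not E (· ∈ q)]
    have a1 := iht (E.filter (· ∈ q)) K (fun x hx => by
      obtain ⟨d, hd, hd2, _⟩ := h1 x hx; exact ⟨d, by omega, hd2⟩)
    have a2 := ihf (E.filter (¬ · ∈ q)) K (fun x hx => by
      obtain ⟨d, hd, hd2, _⟩ := h2 x hx; exact ⟨d, by omega, hd2⟩)
    rw [Finset.sum_congr rfl (g := fun x => 2 ^ (K - t.depth x)) (fun x hx => by
      obtain ⟨d, hd, hd2, h3⟩ := h1 x hx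
      rw [h3, Nat.add_sub_add_right])]
    rw [Finset.sum_congr (s₁ := E.filter (¬ · ∈ q)) rfl (g := fun x => 2 ^ (K - f.depth x)) (fun x hx => by
      obtain ⟨d, hd, hd2, h3⟩ := h2 x hx
      rw [h3, Nat.add_sub_add_right])]
    rw [pow_succ]; omega

/-- From heights to trees. -/
lemma tree_of_heights {M : ℕ} (hM : 3 ≤ M) {μ : Fin n → ℝ} (hμ : IsDistribution μ)
    (g : Fin n → ℕ) (G : ℕ) (hs : ∑ x ∈ Finset.univ.filter (fun x => μ x ≠ 0), 2 ^ g x ≤ 2 ^ G) :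
    ∃ T : DTree (Fin n), IsValid T μ ∧ UsesQuestions T ↑(QS n (2*M)) ∧
      cost T μ ≤ ∑ x, μ x * ((G : ℝ) - g x) + 2 / ((M : ℝ) - 1) := by
  classical
  set E := Finset.univ.filter (fun x => μ x ≠ 0) with hE
  have sumE : ∀ f : Fin n → ℝ, ∑ x ∈ E, μ x * f x = ∑ x, μ x * f x := by
    intro f
    refine Finset.sum_subset (Finset.subset_univ _) fun x _ hx => ?_
    have : μ x = 0 := by simpa [hE] using hx
    rw [this, zero_mul]
  have hE1 : ∑ x ∈ E, μ x = 1 := by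
    have := sumE (fun _ => 1)
    simpa [hμ.2] using this
  have hne : E.Nonempty := by
    rw [Finset.nonempty_iff_ne_empty]; intro h
    rw [h] at hE1; simp at hE1
  have hC : Cfg (2*M) μ (fun x => {x}) (fun _ => 0) ∅ E :=
    { disj := by simp
      pw := by
        intro x _ y _ hxy
        simpa [Function.onFun] using hxy
      ach := by simp
      card := by simp
      eD := by simp
      cD := by simp }
  have := P1_of_P2 hM hμ.1 rfl (P2_all hM hμ.1 rfl G) (fun x => {x}) (fun _ => 0) g ∅ E hC
    (by simpa using hne) (by simp) (by simpa using hs)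
  obtain ⟨T, h1, h2, h3, h4, h5⟩ := this
  simp only [Finset.empty_union, Finset.biUnion_singleton_eq_self] at h2 h3 h5
  refine ⟨T, ⟨h1, ?_, ?_⟩, h4, ?_⟩
  · intro x; rw [h2]; simp [hE]
  · intro x hx; exact h3 x (by simp [hE, hx])
  · rw [cost, ← sumE, ← sumE]
    refine h5.trans ?_
    simp [CC, hE1]

lemma achieves {M : ℕ} (hM : 3 ≤ M) {ρ : ℝ} (hρ : 2 / ((M : ℝ) - 1) < ρ) :
    AchievesProlixity (QS n (2*M)) ρ := by
  intro μ hμ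
  have hne : { c | ∃ T : DTree (Fin n), IsValid T μ ∧ c = cost T μ }.Nonempty := by
    obtain ⟨T, h, _⟩ := tree_of_heights hM hμ (fun _ => 0) n (by
      have h1 := Finset.card_filter_le (Finset.univ : Finset (Fin n)) (fun x => μ x ≠ 0)
      have h2 := Nat.lt_two_pow_self (n := n)
      simp at h1 ⊢
      omega)
    exact ⟨_, T, h, rfl⟩
  obtain ⟨c, ⟨T, hT, rfl⟩, hc⟩ := exists_lt_of_csInf_lt hne
    (show sInf _ < OptCost μ + (ρ - 2 / ((M : ℝ) - 1)) by
      change OptCost μ < _; linarith)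
  set K := Finset.univ.sup (fun x => T.depth x) with hK
  have hdK : ∀ x, T.depth x ≤ K := fun x =>
    Finset.le_sup (f := fun x => T.depth x) (Finset.mem_univ x)
  obtain ⟨T', h1, h2, h3⟩ := tree_of_heights hM hμ (fun x => K - T.depth x) K
    (kraft T _ K fun x hx => ⟨T.depth x, hdK x, hT.finds x (by simpa using hx)⟩)
  refine ⟨T', h1, h2, ?_⟩
  have : ∑ x, μ x * ((K : ℝ) - ((K - T.depth x : ℕ) : ℝ)) = cost T μ := by
    rw [cost]
    refine Finset.sum_congr rfl fun x _ => ?_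
    rw [Nat.cast_sub (hdK x)]; ring
  rw [this] at h3
  linarith

lemma card_QS (s : ℕ) (hs : 1 ≤ s) (hsn : s ≤ n) :
    ((QS n s).card : ℝ) ≤ ((n : ℝ) + 1) * (Real.exp 1 * n / s) ^ s := by
  have h1 : (QS n s).card ≤ (n+1) * ∑ j ∈ Finset.range (s+1), n.choose j := by
    refine Finset.card_image_le.trans ?_
    rw [Finset.card_product, Finset.card_range]
    refine Nat.mul_le_mul_left _ ?_
    have : (Finset.univ : Finset (Finset (Fin n))).filter (fun B => B.card ≤ s) ⊆
        (Finset.range (s+1)).biUnion (fun j => Finset.powersetCard j Finset.univ) := by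
      intro B hB
      simp at hB ⊢
      omega
    refine (Finset.card_le_card this).trans (Finset.card_biUnion_le.trans ?_)
    simp
  have hn0 : (0:ℝ) < n := by exact_mod_cast (by omega : 0 < n)
  have hs0 : (0:ℝ) < s := by exact_mod_cast (by omega : 0 < s)
  have hsn' : (s:ℝ) ≤ n := by exact_mod_cast hsn
  have h2 : (∑ j ∈ Finset.range (s+1), (n.choose j : ℝ)) ≤ (Real.exp 1 * n / s) ^ s := by
    have a1 : (∑ j ∈ Finset.range (s+1), (n.choose j : ℝ)) * ((s:ℝ)/n) ^ s ≤ (1 + (s:ℝ)/n) ^ n := by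
      rw [add_comm (1:ℝ) ((s:ℝ)/n), add_pow, Finset.sum_mul]
      refine le_trans (Finset.sum_le_sum (fun j hj => ?_)) (Finset.sum_le_sum_of_subset_of_nonneg
        (Finset.range_mono (by omega : s + 1 ≤ n + 1)) fun j _ _ => by positivity)
      rw [one_pow, mul_one, mul_comm]
      refine mul_le_mul_of_nonneg_right ?_ (by positivity)
      refine pow_le_pow_of_le_one (by positivity) ((div_le_one hn0).2 hsn') ?_
      have := Finset.mem_range.1 hj; omega
    have a2 : (1 + (s:ℝ)/n) ^ n ≤ Real.exp 1 ^ s := by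
      have : 1 + (s:ℝ)/n ≤ Real.exp ((s:ℝ)/n) := by linarith [Real.add_one_le_exp ((s:ℝ)/n)]
      refine (pow_le_pow_left₀ (by positivity) this n).trans ?_
      rw [← Real.exp_nat_mul, ← Real.exp_nat_mul]
      apply Real.exp_le_exp.2
      field_simp; exact le_refl _
    have a3 : (Real.exp 1 * n / s) ^ s = Real.exp 1 ^ s / ((s:ℝ)/n)^s := by
      rw [← div_pow]; congr 1; field_simp
    rw [a3, le_div_iff₀ (by positivity)]
    exact a1.trans a2
  calc ((QS n s).card : ℝ) ≤ ((n+1) * ∑ j ∈ Finset.range (s+1), n.choose j : ℕ) := by exact_mod_cast h1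
    _ = ((n:ℝ)+1) * ∑ j ∈ Finset.range (s+1), (n.choose j : ℝ) := by push_cast; rfl
    _ ≤ _ := by gcongr

end main
end TQ

open TQ in
/-- For `r = 4/2^k` (integer `k ≥ 3`) and `n > 2^k`:
`u_Opt(n, r + r²) ≤ n²·((3e/4)·r·n)^{4/r}`. -/
theorem uOpt_prolixity_upper (k : ℕ) (hk : 3 ≤ k) (r : ℝ) (hr : r = 4 / 2 ^ k)
    (n : ℕ) (hn : 2 ^ k < n) :
    (uOpt n (r + r ^ 2) : ℝ)
      ≤ (n : ℝ) ^ 2 * ((3 * Real.exp 1 / 4) * r * n) ^ ((4 : ℝ) / r) := by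
  obtain ⟨j, rfl⟩ : ∃ j, k = j + 1 := ⟨k - 1, by omega⟩
  have hM4 : 4 ≤ 2 ^ j := by
    calc 4 = 2 ^ 2 := by norm_num
      _ ≤ 2 ^ j := Nat.pow_le_pow_right (by norm_num) (by omega)
  have hM : (4:ℝ) ≤ (2:ℝ) ^ j := by exact_mod_cast hM4
  have hs : 2 * 2 ^ j = 2 ^ (j + 1) := by ring
  have hach : AchievesProlixity (QS n (2 * 2 ^ j)) (r + r ^ 2) := by
    refine achieves (by omega) ?_
    push_cast
    rw [hr, pow_succ]
    set m : ℝ := (2:ℝ) ^ j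
    have e1 : 4 / (m * 2) + (4 / (m * 2)) ^ 2 = (2 * m + 4) / m ^ 2 := by field_simp; ring
    rw [e1, div_lt_div_iff₀ (by linarith) (by positivity)]
    nlinarith
  have h1 : uOpt n (r + r ^ 2) ≤ (QS n (2 * 2 ^ j)).card := Nat.sInf_le ⟨_, rfl, hach⟩
  have h2 := card_QS (n := n) (2 * 2 ^ j) (by omega) (by omega)
  have hn8 : (8:ℝ) ≤ n := by exact_mod_cast (by omega : 8 ≤ n)
  have e1 : (4:ℝ) / r = ((2 * 2 ^ j : ℕ) : ℝ) := by
    rw [hr]; push_cast; field_simp; ring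
  have e2 : (3 * Real.exp 1 / 4) * r * n = 3 * (Real.exp 1 * n / ((2 * 2 ^ j : ℕ) : ℝ)) := by
    rw [hr]; push_cast; field_simp; ring
  rw [e1, e2, Real.rpow_natCast]
  have hpos : 0 ≤ Real.exp 1 * n / ((2 * 2 ^ j : ℕ) : ℝ) := by positivity
  calc (uOpt n (r + r ^ 2) : ℝ) ≤ ((QS n (2 * 2 ^ j)).card : ℝ) := by exact_mod_cast h1
    _ ≤ _ := h2
    _ ≤ _ := by
      refine mul_le_mul (by nlinarith) (pow_le_pow_left₀ hpos (by linarith) _)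
        (by positivity) (by positivity)
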